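/- Let P, Q, Q′, R, R′, S be cochain complexes in an additive category, let α: P → Q and β: P → R be chain maps, let u: Q → Q′ and v: R → R′ be chain maps that are homotopy equivalences, and let γ: Q′ → S and δ: R′ → S be chain maps such that δ∘v∘β = γ∘u∘α. Form the two iterated mapping cones: C₁ = Cone(M₁), where M₁: Cone(α: P → Q) → Cone(δ: R′ → S) is the chain map (q, p) ↦ (γ(u q), v(β p)) induced by the commutative square with top row α, bottom row δ, left column v∘β and right column γ∘u; and C₂ = Cone(M₂), where M₂: Cone(u∘α: P → Q′) → Cone(δ∘v: R → S) is the chain map (q′, p) ↦ (γ q′, β p) induced by the commutative square with top row u∘α, bottom row δ∘v, left column β and right column γ. Then C₁ and C₂ are chain homotopy equivalent. (This is the homologically formal content of the paper's Main Theorem B, the categorified 4T relation: the mapping cones of the two induced morphisms are chain homotopic to each other.) -/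

import Mathlib

open CategoryTheory CategoryTheory.Limits

set_option linter.unusedSectionVars false

/-- A cochain complex indexed by `ℤ` in an additive category `C`;
`d` denotes the differential. -/
structure Cplx (C : Type*) [Category C] [Preadditive C] where
  X : ℤ → C
  d : ∀ n : ℤ, X n ⟶ X (n + 1)
  dd : ∀ n : ℤ, d n ≫ d (n + 1) = 0

variable {C : Type*} [Category C] [Preadditive C] [HasBinaryBiproducts C]

/-- A degreewise family of morphisms `φⁿ : Aⁿ ⟶ Bⁿ` is a chain map:
`d ∘ φ = φ ∘ d` in every degree. -/
def IsChainMap (A B : Cplx C) (φ : ∀ n : ℤ, A.X n ⟶ B.X n) : Prop :=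
  ∀ n : ℤ, A.d n ≫ φ (n + 1) = φ n ≫ B.d n

@[simp]
theorem dd_assoc (A : Cplx C) (n : ℤ) {Z : C} (f : A.X (n + 1 + 1) ⟶ Z) :
    A.d n ≫ A.d (n + 1) ≫ f = 0 := by
  rw [← Category.assoc, A.dd, zero_comp]

/-- The mapping cone of a chain map `δ : X₀ → Y₀`:
`Cone(δ)ⁿ = Y₀ⁿ ⊕ X₀ⁿ⁺¹`, with differential `(y, x) ↦ (d y + δ x, −d x)`. -/
noncomputable def MCone (X₀ Y₀ : Cplx C) (δ : ∀ n : ℤ, X₀.X n ⟶ Y₀.X n)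
    (hδ : IsChainMap X₀ Y₀ δ) : Cplx C where
  X n := Y₀.X n ⊞ X₀.X (n + 1)
  d n := biprod.desc (biprod.lift (Y₀.d n) 0) (biprod.lift (δ (n + 1)) (-(X₀.d (n + 1))))
  dd n := by
    apply biprod.hom_ext' <;> apply biprod.hom_ext <;>
      simp [Y₀.dd, X₀.dd, hδ (n + 1)]

/-- Two degreewise families of morphisms are chain homotopic: there is a family
`hⁿ : Aⁿ ⟶ Bⁿ⁻¹` with `d ∘ h + h ∘ d = φ − ψ` in every degree. -/
def Homotopic (A B : Cplx C) (φ ψ : ∀ n : ℤ, A.X n ⟶ B.X n) : Prop :=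
  ∃ h : ∀ n : ℤ, A.X (n + 1) ⟶ B.X n,
    ∀ n : ℤ, h n ≫ B.d n + A.d (n + 1) ≫ h (n + 1) = φ (n + 1) - ψ (n + 1)

/-- A degreewise family of morphisms is a chain homotopy equivalence:
it is a chain map admitting a two-sided inverse up to homotopy. -/
def IsHtpyEquiv (A B : Cplx C) (φ : ∀ n : ℤ, A.X n ⟶ B.X n) : Prop :=
  IsChainMap A B φ ∧ ∃ ψ : ∀ n : ℤ, B.X n ⟶ A.X n, IsChainMap B A ψ ∧
    Homotopic A A (fun n => φ n ≫ ψ n) (fun n => 𝟙 (A.X n)) ∧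
    Homotopic B B (fun n => ψ n ≫ φ n) (fun n => 𝟙 (B.X n))

/-- A degreewise family of morphisms is an isomorphism of cochain complexes. -/
def IsCplxIso (A B : Cplx C) (φ : ∀ n : ℤ, A.X n ⟶ B.X n) : Prop :=
  IsChainMap A B φ ∧ ∃ ψ : ∀ n : ℤ, B.X n ⟶ A.X n, IsChainMap B A ψ ∧
    (∀ n : ℤ, φ n ≫ ψ n = 𝟙 (A.X n)) ∧ (∀ n : ℤ, ψ n ≫ φ n = 𝟙 (B.X n))

/-- Two cochain complexes are isomorphic. -/
def CplxIsomorphic (A B : Cplx C) : Prop := ∃ φ, IsCplxIso A B φ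

/-- Two cochain complexes are chain homotopy equivalent. -/
def HtpyEquivalent (A B : Cplx C) : Prop := ∃ φ, IsHtpyEquiv A B φ

theorem IsChainMap.comp {A B D : Cplx C} {φ : ∀ n : ℤ, A.X n ⟶ B.X n}
    {ψ : ∀ n : ℤ, B.X n ⟶ D.X n} (h₁ : IsChainMap A B φ) (h₂ : IsChainMap B D ψ) :
    IsChainMap A D (fun n => φ n ≫ ψ n) := by
  intro n
  rw [← Category.assoc, h₁ n, Category.assoc, h₂ n, ← Category.assoc]

/-- A strictly commutative square of chain maps (top `t`, bottom `s`, left `l`, right `r`)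
induces a chain map of mapping cones, given degreewise by `(q, p) ↦ (r q, l p)`. -/
theorem coneSq_isChainMap {P Q R S : Cplx C}
    {t : ∀ n : ℤ, P.X n ⟶ Q.X n} (ht : IsChainMap P Q t)
    {s : ∀ n : ℤ, R.X n ⟶ S.X n} (hs : IsChainMap R S s)
    {l : ∀ n : ℤ, P.X n ⟶ R.X n} (hl : IsChainMap P R l)
    {r : ∀ n : ℤ, Q.X n ⟶ S.X n} (hr : IsChainMap Q S r)
    (hcomm : ∀ n : ℤ, t n ≫ r n = l n ≫ s n) :
    IsChainMap (MCone P Q t ht) (MCone R S s hs)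
      (fun n => biprod.desc (biprod.lift (r n) 0) (biprod.lift 0 (l (n + 1)))) := by
  intro n
  apply biprod.hom_ext' <;> apply biprod.hom_ext <;>
    simp [MCone, hr n, hl (n + 1), hcomm (n + 1), reassoc_of% hcomm (n + 1)]

/-- The data of a homotopy equivalence can be chosen coherently: the two homotopies `h`, `k`
satisfy `φ ∘ h - k ∘ φ = d ∘ t - t ∘ d` for some family `t` of degree `-2`. -/
theorem IsHtpyEquiv.exists_coherent {A B : Cplx C} {φ : ∀ n : ℤ, A.X n ⟶ B.X n}
    (hφ : IsHtpyEquiv A B φ) :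
    ∃ (ψ : ∀ n : ℤ, B.X n ⟶ A.X n) (h : ∀ n : ℤ, A.X (n + 1) ⟶ A.X n)
      (k : ∀ n : ℤ, B.X (n + 1) ⟶ B.X n) (t : ∀ n : ℤ, A.X (n + 1 + 1) ⟶ B.X n),
      IsChainMap B A ψ ∧
      (∀ n, h n ≫ A.d n + A.d (n + 1) ≫ h (n + 1) = φ (n + 1) ≫ ψ (n + 1) - 𝟙 _) ∧
      (∀ n, k n ≫ B.d n + B.d (n + 1) ≫ k (n + 1) = ψ (n + 1) ≫ φ (n + 1) - 𝟙 _) ∧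
      ∀ n, t n ≫ B.d n - A.d (n + 1 + 1) ≫ t (n + 1) =
        h (n + 1) ≫ φ (n + 1) - φ (n + 1 + 1) ≫ k (n + 1) := by
  obtain ⟨hc, ψ, hψ, ⟨h, hh⟩, ⟨k, hk⟩⟩ := hφ
  let e (n : ℤ) : A.X (n + 1) ⟶ B.X n := h n ≫ φ n - φ (n + 1) ≫ k n
  have he (n : ℤ) : e n ≫ B.d n = -(A.d (n + 1) ≫ e (n + 1)) := by
    have h1 := hh n =≫ φ (n + 1)
    have h2 := φ (n + 1) ≫= hk n
    simp only [Preadditive.add_comp, Preadditive.comp_add, Preadditive.sub_comp,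
      Preadditive.comp_sub, Category.assoc, Category.id_comp, Category.comp_id] at h1 h2
    have h3 := h1.trans h2.symm
    simp only [e, Preadditive.sub_comp, Preadditive.comp_sub, Category.assoc, ← hc n]
    rw [← Category.assoc (A.d (n + 1)) (φ (n + 1 + 1)), hc (n + 1), Category.assoc,
      ← sub_eq_zero, ← sub_eq_zero.mpr h3]
    abel
  refine ⟨ψ, fun n => h n - e n ≫ ψ n, k, fun n => -(e (n + 1) ≫ k n), hψ, fun n => ?_, hk,
    fun n => ?_⟩
  · have h1 := he n =≫ ψ (n + 1)
    simp only [Category.assoc, Preadditive.neg_comp] at h1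
    simp only [Preadditive.sub_comp, Preadditive.comp_sub, Category.assoc, ← hψ n, h1, ← hh n]
    abel
  · have h1 := he (n + 1) =≫ k (n + 1)
    have h2 := e (n + 1) ≫= hk n
    simp only [Category.assoc, Preadditive.neg_comp, Preadditive.comp_add, Preadditive.comp_sub,
      Category.comp_id] at h1 h2
    rw [h1] at h2
    simp only [Preadditive.sub_comp, Preadditive.neg_comp, Preadditive.comp_neg, Category.assoc]
    rw [← sub_eq_zero] at h2 ⊢
    rw [← neg_eq_zero, ← h2]
    simp only [e]
    abel

/-- A criterion for an endomorphism of a mapping cone to be homotopic to the identity, in terms of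
the biproducts defining the cone. -/
theorem homotopic_id_mCone {A B : Cplx C} {f : ∀ n : ℤ, A.X n ⟶ B.X n} (hf : IsChainMap A B f)
    {φ : ∀ n : ℤ, B.X n ⊞ A.X (n + 1) ⟶ B.X n ⊞ A.X (n + 1)}
    (h : ∀ n : ℤ, B.X (n + 1) ⊞ A.X (n + 1 + 1) ⟶ B.X n ⊞ A.X (n + 1))
    (hh : ∀ n : ℤ,
      h n ≫ biprod.desc (biprod.lift (B.d n) 0) (biprod.lift (f (n + 1)) (-A.d (n + 1))) +
        biprod.desc (biprod.lift (B.d (n + 1)) 0)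
          (biprod.lift (f (n + 1 + 1)) (-A.d (n + 1 + 1))) ≫ h (n + 1) = φ (n + 1) - 𝟙 _) :
    Homotopic (MCone A B f hf) (MCone A B f hf) φ (fun n => 𝟙 ((MCone A B f hf).X n)) :=
  ⟨h, hh⟩

/-- Postcomposition with a homotopy equivalence induces a homotopy equivalence of cones. -/
theorem IsHtpyEquiv.mCone_postcomp {A B B' : Cplx C} {f : ∀ n : ℤ, A.X n ⟶ B.X n}
    (hf : IsChainMap A B f) {b : ∀ n : ℤ, B.X n ⟶ B'.X n} (hb : IsHtpyEquiv B B' b)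
    {g : ∀ n : ℤ, A.X n ⟶ B'.X n} (hg : IsChainMap A B' g) (hfg : ∀ n, f n ≫ b n = g n) :
    IsHtpyEquiv (MCone A B f hf) (MCone A B' g hg)
      (fun n => biprod.desc (biprod.lift (b n) 0) (biprod.lift 0 (𝟙 (A.X (n + 1))))) := by
  obtain rfl : g = fun n => f n ≫ b n := funext fun n => (hfg n).symm
  refine ⟨coneSq_isChainMap hf hg (l := fun n => 𝟙 (A.X n)) (fun n => by simp) hb.1
    (fun n => by simp), ?_⟩
  obtain ⟨c, h, k, t, hc, hh, hk, ht⟩ := hb.exists_coherent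
  refine ⟨fun n => biprod.desc (biprod.lift (c n) 0) (biprod.lift (f (n + 1) ≫ h n) (𝟙 _)),
    fun n => ?_,
    homotopic_id_mCone _ (fun n => biprod.desc (biprod.lift (h n) 0) 0) fun n => ?_,
    homotopic_id_mCone _ (fun n => biprod.desc (biprod.lift (k n) 0) (biprod.lift (f (n + 1 + 1) ≫ t n) 0))
      fun n => ?_⟩
  · have h1 := f (n + 1) ≫= hh n
    simp only [Preadditive.comp_add, Preadditive.comp_sub, Category.comp_id] at h1
    apply biprod.hom_ext' <;> apply biprod.hom_ext <;> simp [MCone, hc n]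
    rw [← Category.assoc (A.d _), hf (n + 1), Category.assoc, ← sub_eq_zero,
      ← sub_eq_zero.mpr h1.symm]
    abel
  · apply biprod.hom_ext' <;> apply biprod.hom_ext <;> simp [MCone, hh n]
  · have h1 := f (n + 1 + 1) ≫= ht n
    simp only [Preadditive.comp_sub] at h1
    apply biprod.hom_ext' <;> apply biprod.hom_ext <;> simp [MCone, hk n]
    rw [← Category.assoc (A.d _), hf (n + 1 + 1), Category.assoc, ← sub_eq_zero,
      ← sub_eq_zero.mpr h1]
    abel

/-- Precomposition with a homotopy equivalence induces a homotopy equivalence of cones. -/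
theorem IsHtpyEquiv.mCone_precomp {A A' B : Cplx C} {a : ∀ n : ℤ, A.X n ⟶ A'.X n}
    (ha : IsHtpyEquiv A A' a) {g : ∀ n : ℤ, A'.X n ⟶ B.X n} (hg : IsChainMap A' B g)
    {f : ∀ n : ℤ, A.X n ⟶ B.X n} (hf : IsChainMap A B f) (hfg : ∀ n, a n ≫ g n = f n) :
    IsHtpyEquiv (MCone A B f hf) (MCone A' B g hg)
      (fun n => biprod.desc (biprod.lift (𝟙 (B.X n)) 0) (biprod.lift 0 (a (n + 1)))) := by
  obtain rfl : f = fun n => a n ≫ g n := funext fun n => (hfg n).symm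
  refine ⟨coneSq_isChainMap hf hg (r := fun n => 𝟙 (B.X n)) ha.1 (fun n => by simp)
    (fun n => by simp), ?_⟩
  obtain ⟨c, h, k, t, hc, hh, hk, ht⟩ := ha.exists_coherent
  refine ⟨fun n => biprod.desc (biprod.lift (𝟙 _) 0) (biprod.lift (-(k n ≫ g n)) (c (n + 1))),
    fun n => ?_,
    homotopic_id_mCone _ (fun n => biprod.desc 0 (biprod.lift (t n ≫ g n) (-h (n + 1)))) fun n => ?_,
    homotopic_id_mCone _ (fun n => biprod.desc 0 (biprod.lift 0 (-k (n + 1)))) fun n => ?_⟩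
  · have h1 := hk n =≫ g (n + 1)
    simp only [Preadditive.add_comp, Preadditive.sub_comp, Category.assoc,
      Category.id_comp] at h1
    apply biprod.hom_ext' <;> apply biprod.hom_ext <;> simp [MCone, hc (n + 1)]
    rw [← hg n, ← sub_eq_zero, ← sub_eq_zero.mpr h1]
    abel
  · have h1 := ht n =≫ g (n + 1)
    simp only [Preadditive.sub_comp, Category.assoc] at h1
    apply biprod.hom_ext' <;> apply biprod.hom_ext <;> simp [MCone, ← hh (n + 1)]
    rw [← hg n, ← sub_eq_zero, ← sub_eq_zero.mpr h1]
    abel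
  · apply biprod.hom_ext' <;> apply biprod.hom_ext <;> simp [MCone, ← hk (n + 1)]

theorem HtpyEquivalent.symm {A B : Cplx C} : HtpyEquivalent A B → HtpyEquivalent B A := by
  rintro ⟨φ, hφ, ψ, hψ, h, k⟩
  exact ⟨ψ, hψ, φ, hφ, k, h⟩

/-- If `ψ ∘ φ` and `ψ' ∘ φ'` are homotopic to identities, then so is `ψ ∘ ψ' ∘ φ' ∘ φ`. -/
theorem Homotopic.comp_id {A B : Cplx C} {φ : ∀ n : ℤ, A.X n ⟶ B.X n}
    {ψ : ∀ n : ℤ, B.X n ⟶ A.X n} {χ : ∀ n : ℤ, B.X n ⟶ B.X n} (hφ : IsChainMap A B φ)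
    (hψ : IsChainMap B A ψ) (h : Homotopic A A (fun n => φ n ≫ ψ n) (fun n => 𝟙 (A.X n)))
    (hχ : Homotopic B B χ (fun n => 𝟙 (B.X n))) :
    Homotopic A A (fun n => φ n ≫ χ n ≫ ψ n) (fun n => 𝟙 (A.X n)) := by
  obtain ⟨h, hh⟩ := h
  obtain ⟨k, hk⟩ := hχ
  refine ⟨fun n => h n + φ (n + 1) ≫ k n ≫ ψ n, fun n => ?_⟩
  have h1 := φ (n + 1) ≫= hk n =≫ ψ (n + 1)
  simp only [Preadditive.add_comp, Preadditive.sub_comp, Preadditive.comp_add,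
    Preadditive.comp_sub, Category.assoc, Category.id_comp] at h1
  simp only [Preadditive.add_comp, Preadditive.comp_add, Category.assoc, ← hψ n]
  rw [← Category.assoc (A.d _) (φ _), hφ (n + 1), Category.assoc,
    ← sub_add_sub_cancel _ (φ (n + 1) ≫ ψ (n + 1)), ← h1, ← hh n]
  abel

theorem HtpyEquivalent.trans {A B D : Cplx C} :
    HtpyEquivalent A B → HtpyEquivalent B D → HtpyEquivalent A D := by
  rintro ⟨φ, hφ, ψ, hψ, h, k⟩ ⟨φ', hφ', ψ', hψ', h', k'⟩
  refine ⟨fun n => φ n ≫ φ' n, hφ.comp hφ', fun n => ψ' n ≫ ψ n, hψ'.comp hψ, ?_, ?_⟩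
  · simpa only [Category.assoc] using h.comp_id hφ hψ h'
  · simpa only [Category.assoc] using k'.comp_id hψ' hφ' k

/-- categorified 4T relation, homotopy-theoretic core. Given chain maps
`α : P → Q`, `β : P → R`, homotopy equivalences `u : Q → Q′`, `v : R → R′` and chain maps
`γ : Q′ → S`, `δ : R′ → S` with `δ∘v∘β = γ∘u∘α`, the iterated mapping cones
`Cone(Cone(α) → Cone(δ))` and `Cone(Cone(u∘α) → Cone(δ∘v))` (cones of the chain maps induced
by the two commutative squares) are chain homotopy equivalent. -/
theorem categorified_4T (P Q Q' R R' S : Cplx C)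
    (α : ∀ n : ℤ, P.X n ⟶ Q.X n) (hα : IsChainMap P Q α)
    (β : ∀ n : ℤ, P.X n ⟶ R.X n) (hβ : IsChainMap P R β)
    (u : ∀ n : ℤ, Q.X n ⟶ Q'.X n) (hu : IsHtpyEquiv Q Q' u)
    (v : ∀ n : ℤ, R.X n ⟶ R'.X n) (hv : IsHtpyEquiv R R' v)
    (γ : ∀ n : ℤ, Q'.X n ⟶ S.X n) (hγ : IsChainMap Q' S γ)
    (δ : ∀ n : ℤ, R'.X n ⟶ S.X n) (hδ : IsChainMap R' S δ)
    (hsq : ∀ n : ℤ, β n ≫ v n ≫ δ n = α n ≫ u n ≫ γ n) :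
    HtpyEquivalent
      (MCone (MCone P Q α hα) (MCone R' S δ hδ)
        (fun n => biprod.desc (biprod.lift (u n ≫ γ n) 0)
          (biprod.lift 0 (β (n + 1) ≫ v (n + 1))))
        (coneSq_isChainMap hα hδ (hβ.comp hv.1) (hu.1.comp hγ)
          (fun n => by simpa only [Category.assoc] using (hsq n).symm)))
      (MCone (MCone P Q' (fun n => α n ≫ u n) (hα.comp hu.1))
        (MCone R S (fun n => v n ≫ δ n) (hv.1.comp hδ))
        (fun n => biprod.desc (biprod.lift (γ n) 0) (biprod.lift 0 (β (n + 1))))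
        (coneSq_isChainMap (hα.comp hu.1) (hv.1.comp hδ) hβ hγ
          (fun n => by simpa only [Category.assoc] using (hsq n).symm))) := by
  have hγ' (n : ℤ) : (α n ≫ u n) ≫ γ n = (β n ≫ v n) ≫ δ n := by
    simpa only [Category.assoc] using (hsq n).symm
  let hM := coneSq_isChainMap (hα.comp hu.1) hδ (hβ.comp hv.1) hγ hγ'
  refine HtpyEquivalent.trans
    ⟨_, (hu.mCone_postcomp hα (hα.comp hu.1) fun _ => rfl).mCone_precomp hM _ fun n => ?_⟩
    (HtpyEquivalent.symm
      ⟨_, (hv.mCone_precomp hδ (hv.1.comp hδ) fun _ => rfl).mCone_postcomp _ hM fun n => ?_⟩) <;>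
  apply biprod.hom_ext' <;> apply biprod.hom_ext <;> simp [MCone]
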